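/- arXiv:1305.0924 — 2 statements merged into one kernel-verified Lean document; each statement's English description precedes it below -/
import Mathlib

section
/- Let 0 < a < 1. For every z in the upper half-plane ℂ⁺, the Cauchy transform of the beta prime distribution β'_{1−a,a} is G_{β'_{1−a,a}}(z) = (1 − (−z)^{−a})/(1+z), where the power is the principal branch (well defined since −z ∈ ℂ∖(−∞,0] for z ∈ ℂ⁺). -/
open MeasureTheory Complex Set

/-- The Cauchy transform `∫ 1/(z-x) dμ(x)` of a measure on ℝ. -/
noncomputable def cauchyT (μ : Measure ℝ) (z : ℂ) : ℂ := ∫ x, (z - (x : ℂ))⁻¹ ∂μ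

/-- The Euler beta function `B(p,q) = ∫₀¹ x^(p-1) (1-x)^(q-1) dx`. -/
noncomputable def betaFun (p q : ℝ) : ℝ := ∫ x in Ioo (0:ℝ) 1, x ^ (p - 1) * (1 - x) ^ (q - 1)

/-- The beta prime distribution `β'_{p,q}` on `[0,∞)`. -/
noncomputable def betaPrimeMeasure (p q : ℝ) : Measure ℝ :=
  volume.withDensity fun x =>
    ENNReal.ofReal ((Ioi (0:ℝ)).indicator
      (fun x => x ^ (p - 1) * (1 + x) ^ (-(p + q)) / betaFun p q) x)

theorem betaFun_eq_beta {p q : ℝ} (hp : 0 < p) (hq : 0 < q) :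
    betaFun p q = ProbabilityTheory.beta p q := by
  rw [ProbabilityTheory.beta_eq_betaIntegralReal p q hp hq, betaIntegral,
    intervalIntegral.integral_of_le zero_le_one, betaFun, ← integral_Ioc_eq_integral_Ioo,
    ← RCLike.re_to_complex, ← integral_re]
  · refine setIntegral_congr_fun measurableSet_Ioc fun x ⟨hx1, hx₂⟩ ↦ ?_
    norm_cast
    rw [← Complex.ofReal_cpow, ← Complex.ofReal_cpow, RCLike.re_to_complex,
      Complex.re_mul_ofReal, Complex.ofReal_re]
    all_goals linarith
  · have h := betaIntegral_convergent (u := p) (v := q) (by simpa) (by simpa)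
    rwa [intervalIntegrable_iff_integrableOn_Ioc_of_le zero_le_one, IntegrableOn] at h

theorem betaFun_pos {p q : ℝ} (hp : 0 < p) (hq : 0 < q) : 0 < betaFun p q :=
  betaFun_eq_beta hp hq ▸ ProbabilityTheory.beta_pos hp hq

theorem image_div_one_sub_Ioo : (fun t : ℝ => t / (1 - t)) '' Ioo 0 1 = Ioi 0 := by
  ext x
  simp only [mem_image, mem_Ioo, mem_Ioi]
  constructor
  · rintro ⟨t, ⟨h0, h1⟩, rfl⟩
    exact div_pos h0 (sub_pos.2 h1)
  · intro hx
    refine ⟨x / (1 + x), ⟨by positivity, (div_lt_one (by positivity)).2 (by linarith)⟩, ?_⟩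
    field_simp
    ring

theorem integral_rpow_div_one_add (a : ℝ) :
    ∫ x in Ioi (0 : ℝ), x ^ (-a) / (1 + x) = betaFun (1 - a) a := by
  have hderiv : ∀ t ∈ Ioo (0 : ℝ) 1,
      HasDerivWithinAt (fun t : ℝ => t / (1 - t)) (((1 - t) ^ 2)⁻¹) (Ioo 0 1) t := by
    intro t ht
    have h1 : (1 - t) ≠ 0 := (sub_pos.2 ht.2).ne'
    have h := ((hasDerivAt_id t).div ((hasDerivAt_id t).const_sub 1) h1).hasDerivWithinAt
      (s := Ioo 0 1)
    convert! h using 1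
    simp only [id_eq]
    field_simp
    ring
  have hinj : InjOn (fun t : ℝ => t / (1 - t)) (Ioo 0 1) := by
    intro s hs t ht h
    have h1 := (sub_pos.2 hs.2).ne'
    have h2 := (sub_pos.2 ht.2).ne'
    have h3 := (div_eq_div_iff h1 h2).1 h
    linarith
  rw [← image_div_one_sub_Ioo,
    integral_image_eq_integral_abs_deriv_smul measurableSet_Ioo hderiv hinj, betaFun]
  refine setIntegral_congr_fun measurableSet_Ioo fun t ht ↦ ?_
  have h1 : 0 < 1 - t := sub_pos.2 ht.2
  have h2 : (1 - t) ^ (a - 1) = (1 - t) ^ a / (1 - t) := by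
    rw [Real.rpow_sub h1, Real.rpow_one]
  have h3 : (t / (1 - t)) ^ (-a) = t ^ (-a) * (1 - t) ^ a := by
    rw [Real.div_rpow ht.1.le h1.le, Real.rpow_neg h1.le a, div_inv_eq_mul]
  have h4 : 1 - a - 1 = -a := by ring
  simp only [smul_eq_mul]
  rw [abs_of_pos (by positivity), h3, h2, h4]
  field_simp
  ring

theorem integrableOn_rpow_div_one_add {a : ℝ} (ha0 : 0 < a) (ha1 : a < 1) :
    IntegrableOn (fun x : ℝ => x ^ (-a) / (1 + x)) (Ioi 0) := by
  refine Integrable.of_integral_ne_zero ?_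
  rw [integral_rpow_div_one_add]
  exact (betaFun_pos (sub_pos.2 ha1) ha0).ne'

theorem rpow_div_add_mul_eq {a w x : ℝ} (hw : 0 < w) (hx : 0 < x) :
    (w * x) ^ (-a) / (w + w * x) = w ^ (-a - 1) * (x ^ (-a) / (1 + x)) := by
  rw [Real.mul_rpow hw.le hx.le, Real.rpow_sub hw, Real.rpow_one]
  field_simp

theorem integrableOn_rpow_div_add {a w : ℝ} (ha0 : 0 < a) (ha1 : a < 1) (hw : 0 < w) :
    IntegrableOn (fun x : ℝ => x ^ (-a) / (w + x)) (Ioi 0) := by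
  have h := (integrableOn_Ioi_comp_mul_left_iff (fun x : ℝ => x ^ (-a) / (w + x)) 0 hw).1
  rw [mul_zero] at h
  refine h (IntegrableOn.congr_fun ((integrableOn_rpow_div_one_add ha0 ha1).const_mul
    (w ^ (-a - 1))) (fun x hx ↦ ?_) measurableSet_Ioi)
  exact (rpow_div_add_mul_eq hw hx).symm

theorem integral_rpow_div_add (a : ℝ) {w : ℝ} (hw : 0 < w) :
    ∫ x in Ioi (0 : ℝ), x ^ (-a) / (w + x) = w ^ (-a) * betaFun (1 - a) a := by
  have h := integral_comp_mul_left_Ioi' (fun x : ℝ => x ^ (-a) / (w + x)) 0 hw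
  rw [mul_zero] at h
  rw [← h, setIntegral_congr_fun measurableSet_Ioi (fun x hx ↦ rpow_div_add_mul_eq hw hx),
    integral_const_mul, integral_rpow_div_one_add, smul_eq_mul, Real.rpow_sub hw, Real.rpow_one]
  field_simp

theorem betaPrimeMeasure_one_sub {a : ℝ} :
    betaPrimeMeasure (1 - a) a = (volume.restrict (Ioi 0)).withDensity
      fun x => ENNReal.ofReal (x ^ (-a) / (1 + x) / betaFun (1 - a) a) := by
  rw [betaPrimeMeasure, ← withDensity_indicator measurableSet_Ioi]
  congr 1
  ext x
  by_cases hx : x ∈ Ioi (0 : ℝ)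
  · simp only [indicator_of_mem hx]
    rw [sub_add_cancel, Real.rpow_neg_one, ← div_eq_mul_inv]
    ring_nf
  · simp [indicator_of_notMem hx]

theorem isFiniteMeasure_betaPrimeMeasure_one_sub {a : ℝ} (ha0 : 0 < a) (ha1 : a < 1) :
    IsFiniteMeasure (betaPrimeMeasure (1 - a) a) := by
  rw [betaPrimeMeasure_one_sub]
  exact isFiniteMeasure_withDensity_ofReal
    ((integrableOn_rpow_div_one_add ha0 ha1).div_const _).2

theorem support_betaPrimeMeasure_subset (p q : ℝ) :
    (betaPrimeMeasure p q).support ⊆ Ici 0 := by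
  refine Measure.support_subset_of_isClosed isClosed_Ici ?_
  rw [mem_ae_iff, betaPrimeMeasure, withDensity_apply _ isClosed_Ici.measurableSet.compl]
  refine setLIntegral_eq_zero isClosed_Ici.measurableSet.compl fun x hx ↦ ?_
  have : x ∉ Ioi (0 : ℝ) := fun h ↦ hx (mem_Ici.2 (mem_Ioi.1 h).le)
  simp [indicator_of_notMem this]

theorem cauchyT_eq_neg_resolventTransform (μ : Measure ℝ) (z : ℂ) :
    cauchyT μ z = -resolventTransform μ z := by
  rw [cauchyT, resolventTransform_apply, ← integral_neg]
  refine integral_congr_ae (.of_forall fun x ↦ ?_)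
  simp [resolvent, ← inv_neg]

theorem differentiableAt_cauchyT {μ : Measure ℝ} [IsFiniteMeasure μ] (hμ : μ.support ⊆ Ici 0)
    {z : ℂ} (hz : -z ∈ slitPlane) : DifferentiableAt ℂ (cauchyT μ) z := by
  have : cauchyT μ = fun z ↦ -resolventTransform μ z :=
    funext (cauchyT_eq_neg_resolventTransform μ)
  rw [this]
  refine (hasDerivAt_resolventTransform z ?_).differentiableAt.neg
  rintro ⟨x, hx, rfl⟩
  have := hμ hx
  simp only [mem_Ici] at this
  rcases hz with h | h <;> simp at h
  linarith

theorem cauchyT_betaPrimeMeasure_neg_ofReal {a w : ℝ} (ha0 : 0 < a) (ha1 : a < 1) (hw : 0 < w) :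
    (1 - (w : ℂ)) * cauchyT (betaPrimeMeasure (1 - a) a) (-w) = 1 - (w : ℂ) ^ (-(a : ℂ)) := by
  have hB := betaFun_pos (sub_pos.2 ha1) ha0
  have hreal : (1 - w) * ∫ x in Ioi (0 : ℝ),
      x ^ (-a) / (1 + x) / betaFun (1 - a) a * (-w - x)⁻¹ = 1 - w ^ (-a) := by
    rw [← integral_const_mul]
    have : ∀ x ∈ Ioi (0 : ℝ), (1 - w) * (x ^ (-a) / (1 + x) / betaFun (1 - a) a * (-w - x)⁻¹) =
        (x ^ (-a) / (1 + x) - x ^ (-a) / (w + x)) / betaFun (1 - a) a := by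
      intro x hx
      have hx : 0 < x := hx
      have h1 : -w - x = -(w + x) := by ring
      rw [h1, inv_neg]
      field_simp
      ring
    rw [setIntegral_congr_fun measurableSet_Ioi this, integral_div,
      integral_sub (integrableOn_rpow_div_one_add ha0 ha1) (integrableOn_rpow_div_add ha0 ha1 hw),
      integral_rpow_div_one_add, integral_rpow_div_add a hw]
    field_simp
  rw [cauchyT, betaPrimeMeasure_one_sub, integral_withDensity_eq_integral_toReal_smul
    (by fun_prop) (by simp)]
  have h : ∀ x ∈ Ioi (0 : ℝ),
      (ENNReal.ofReal (x ^ (-a) / (1 + x) / betaFun (1 - a) a)).toReal • (-(w : ℂ) - x)⁻¹ =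
      ((x ^ (-a) / (1 + x) / betaFun (1 - a) a * (-w - x)⁻¹ : ℝ) : ℂ) := by
    intro x hx
    have hx : 0 < x := hx
    rw [ENNReal.toReal_ofReal (by positivity)]
    simp
  rw [setIntegral_congr_fun measurableSet_Ioi h, integral_complex_ofReal, ← ofReal_neg,
    ← ofReal_cpow hw.le]
  exact_mod_cast hreal

theorem cauchyT_betaPrimeMeasure_neg {a : ℝ} (ha0 : 0 < a) (ha1 : a < 1) {w : ℂ}
    (hw : w ∈ slitPlane) :
    (1 - w) * cauchyT (betaPrimeMeasure (1 - a) a) (-w) = 1 - w ^ (-(a : ℂ)) := by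
  have := isFiniteMeasure_betaPrimeMeasure_one_sub ha0 ha1
  have hf : AnalyticOnNhd ℂ
      (fun w ↦ (1 - w) * cauchyT (betaPrimeMeasure (1 - a) a) (-w)) slitPlane := by
    refine DifferentiableOn.analyticOnNhd (fun u hu ↦ ?_) isOpen_slitPlane
    have h : DifferentiableAt ℂ (cauchyT (betaPrimeMeasure (1 - a) a)) (-u) :=
      differentiableAt_cauchyT (support_betaPrimeMeasure_subset _ _) (by simpa using hu)
    exact ((differentiableAt_id.const_sub 1).mul
      (h.comp u differentiableAt_id.neg)).differentiableWithinAt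
  have hg : AnalyticOnNhd ℂ (fun w : ℂ ↦ 1 - w ^ (-(a : ℂ))) slitPlane := by
    refine DifferentiableOn.analyticOnNhd (fun u hu ↦ ?_) isOpen_slitPlane
    exact ((differentiableAt_id.cpow_const hu).const_sub 1).differentiableWithinAt
  have hconn : IsPreconnected slitPlane :=
    (starConvex_one_slitPlane.isPathConnected one_mem_slitPlane).isConnected.isPreconnected
  refine hf.eqOn_of_preconnected_of_frequently_eq hg hconn one_mem_slitPlane ?_ hw
  have ht : Filter.Tendsto (fun t : ℝ ↦ (t : ℂ)) (nhdsWithin 1 {1}ᶜ) (nhdsWithin 1 {1}ᶜ) := by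
    refine tendsto_nhdsWithin_iff.2 ⟨?_, ?_⟩
    · exact (continuous_ofReal.tendsto' 1 1 (by simp)).mono_left nhdsWithin_le_nhds
    · filter_upwards [self_mem_nhdsWithin] with t ht
      simpa using ht
  refine ht.frequently (Filter.Eventually.frequently ?_)
  filter_upwards [nhdsWithin_le_nhds (Ioi_mem_nhds zero_lt_one)] with t ht
  exact cauchyT_betaPrimeMeasure_neg_ofReal ha0 ha1 ht

theorem stmt_6 (a : ℝ) (ha0 : 0 < a) (ha1 : a < 1)
    (z : ℂ) (hz : 0 < z.im) :
    cauchyT (betaPrimeMeasure (1 - a) a) z = (1 - (-z) ^ (-(a : ℂ))) / (1 + z) := by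
  have hz1 : 1 + z ≠ 0 := fun h ↦ hz.ne' (by simpa using congrArg im h)
  have hs : -z ∈ slitPlane := Or.inr (by simpa using hz.ne')
  have h := cauchyT_betaPrimeMeasure_neg ha0 ha1 hs
  rw [sub_neg_eq_add, neg_neg] at h
  rw [eq_div_iff hz1, mul_comm, h]
end

section
/- Let p, q > 0. There exists a function f analytic on the domain D^{bp} := ℂ∖(−∞,0] such that f(z) = G_{β'_{p,q}}(z) for all z in the upper half-plane ℂ⁺, and such that for all z in the lower half-plane ℂ⁻ = {Im z < 0} one has f(z) = G̃_{β'_{p,q}}(z) − (2πi/B(p,q))·z^{p−1}/(1+z)^{p+q}, where the powers z^{p−1} and (1+z)^{p+q} are the principal branches. -/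
open MeasureTheory Complex Set

/-- The domain `D^{bp} = ℂ ∖ (-∞,0]`. -/
def betaPrimeDomain : Set ℂ := {z : ℂ | ¬ (z.im = 0 ∧ z.re ≤ 0)}

open Metric Filter Topology

/-- A parametric integral of holomorphic functions with an integrable bound is holomorphic. -/
theorem differentiableOn_integral_of_norm_le {α : Type*} [MeasurableSpace α] {μ : Measure α}
    {U : Set ℂ} (hU : IsOpen U) {F : ℂ → α → ℂ} {bound : α → ℝ}
    (hmeas : ∀ z ∈ U, AEStronglyMeasurable (F z) μ)
    (hdiff : ∀ᵐ a ∂μ, DifferentiableOn ℂ (fun z => F z a) U)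
    (hbound : ∀ᵐ a ∂μ, ∀ z ∈ U, ‖F z a‖ ≤ bound a) (hint : Integrable bound μ) :
    DifferentiableOn ℂ (fun z => ∫ a, F z a ∂μ) U := by
  intro z₀ hz₀
  obtain ⟨ε, hε, hεU⟩ := Metric.isOpen_iff.1 hU z₀ hz₀
  set r := ε / 2 with hr
  have hr0 : 0 < r := by positivity
  have hsub : ∀ z ∈ ball z₀ r, closedBall z (r / 2) ⊆ U := by
    intro z hz w hw
    apply hεU
    rw [mem_ball] at hz ⊢
    rw [mem_closedBall] at hw
    linarith [dist_triangle w z z₀]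
  have hballU : ball z₀ r ⊆ U := fun z hz => hsub z hz (mem_closedBall_self (by positivity))
  have hderiv : ∀ᵐ a ∂μ, ∀ z ∈ ball z₀ r,
      HasDerivAt (fun z => F z a) (deriv (fun z => F z a) z) z := by
    filter_upwards [hdiff] with a ha z hz
    exact (ha.differentiableAt (hU.mem_nhds (hballU hz))).hasDerivAt
  have hmeas' : AEStronglyMeasurable (fun a => deriv (fun z => F z a) z₀) μ := by
    let t : ℕ → ℂ := fun n => z₀ + ((r / 2 / ((n : ℝ) + 1) : ℝ) : ℂ)
    have htpos : ∀ n : ℕ, 0 < r / 2 / ((n : ℝ) + 1) := fun n => by positivity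
    have htU : ∀ n, t n ∈ U := by
      intro n
      apply hsub z₀ (mem_ball_self hr0)
      have : r / 2 / ((n : ℝ) + 1) ≤ r / 2 := div_le_self (by positivity) (by simp)
      simpa only [t, mem_closedBall, dist_eq, add_sub_cancel_left, norm_real, Real.norm_eq_abs,
        abs_of_pos (htpos n)] using this
    have htlim : Tendsto t atTop (𝓝[≠] z₀) := by
      rw [tendsto_nhdsWithin_iff]
      constructor
      · have h1 : Tendsto (fun n : ℕ => r / 2 / ((n : ℝ) + 1)) atTop (𝓝 0) :=
          Tendsto.div_atTop tendsto_const_nhds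
            (tendsto_atTop_add_const_right _ _ tendsto_natCast_atTop_atTop)
        have h2 := (continuous_ofReal.tendsto 0).comp h1
        simpa only [t, Function.comp_def, ofReal_zero, add_zero] using h2.const_add z₀
      · refine Eventually.of_forall fun n => ?_
        have := (htpos n).ne'
        simpa only [t, mem_compl_iff, mem_singleton_iff, add_eq_left, ofReal_eq_zero] using this
    refine aestronglyMeasurable_of_tendsto_ae atTop
      (f := fun n a => slope (fun z => F z a) z₀ (t n)) (fun n => ?_) ?_
    · simp only [slope_def_module]
      exact ((hmeas _ (htU n)).sub (hmeas _ hz₀)).const_smul (t n - z₀)⁻¹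
    · filter_upwards [hderiv] with a ha
      exact (ha z₀ (mem_ball_self hr0)).tendsto_slope.comp htlim
  have hbound' : ∀ᵐ a ∂μ, ∀ z ∈ ball z₀ r, ‖deriv (fun z => F z a) z‖ ≤ bound a / (r / 2) := by
    filter_upwards [hdiff, hbound] with a ha hb z hz
    refine norm_deriv_le_of_forall_mem_sphere_norm_le (by positivity) ?_
      fun w hw => hb w (hsub z hz (sphere_subset_closedBall hw))
    exact DifferentiableOn.diffContOnCl
      (ha.mono (closure_ball_subset_closedBall.trans (hsub z hz)))
  exact (hasDerivAt_integral_of_dominated_loc_of_deriv_le (ball_mem_nhds z₀ hr0)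
    (eventually_of_mem (hU.mem_nhds hz₀) hmeas)
    (hint.mono' (hmeas z₀ hz₀) (by filter_upwards [hbound] with a ha using ha z₀ hz₀))
    hmeas' hbound' (hint.div_const _) hderiv).2.differentiableAt.differentiableWithinAt

/-- The Cauchy-type integral `∫ ρ(x)/(z-x) dx` over `S` is holomorphic on every open set whose
points have distance at least `δ` from `S`. -/
theorem differentiableOn_cauchyIntegral {S : Set ℝ} (hS : MeasurableSet S) {ρ : ℝ → ℂ}
    (hρ : IntegrableOn ρ S) {U : Set ℂ} (hU : IsOpen U) {δ : ℝ} (hδ : 0 < δ)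
    (hdist : ∀ z ∈ U, ∀ x ∈ S, δ ≤ ‖z - (x : ℂ)‖) :
    DifferentiableOn ℂ (fun z => ∫ x in S, ρ x * (z - (x : ℂ))⁻¹) U := by
  refine differentiableOn_integral_of_norm_le hU (bound := fun x => ‖ρ x‖ * δ⁻¹) ?_ ?_ ?_
    (hρ.norm.mul_const _)
  · intro z _
    exact hρ.aestronglyMeasurable.mul (by fun_prop : Measurable fun x : ℝ =>
      (z - (x : ℂ))⁻¹).aestronglyMeasurable
  · filter_upwards [ae_restrict_mem hS] with x hx
    refine DifferentiableOn.const_mul (DifferentiableOn.inv (by fun_prop) fun z hz h => ?_) _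
    have := hdist z hz x hx
    rw [h, norm_zero] at this
    linarith
  · filter_upwards [ae_restrict_mem hS] with x hx z hz
    rw [norm_mul, norm_inv]
    gcongr
    exact hdist z hz x hx

theorem abs_im_le_norm_sub_ofReal (z : ℂ) (x : ℝ) : |z.im| ≤ ‖z - (x : ℂ)‖ := by
  simpa using abs_im_le_norm (z - (x : ℂ))

theorem differentiableAt_cauchyIntegral_of_im_ne_zero {S : Set ℝ} (hS : MeasurableSet S)
    {ρ : ℝ → ℂ} (hρ : IntegrableOn ρ S) {z : ℂ} (hz : z.im ≠ 0) :
    DifferentiableAt ℂ (fun z => ∫ x in S, ρ x * (z - (x : ℂ))⁻¹) z := by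
  have hpos : 0 < |z.im| := abs_pos.2 hz
  have hU : IsOpen {w : ℂ | |z.im| / 2 < |w.im|} :=
    isOpen_lt continuous_const (continuous_abs.comp continuous_im)
  refine (differentiableOn_cauchyIntegral hS hρ hU (half_pos hpos)
    fun w hw x _ => ?_).differentiableAt (hU.mem_nhds (by simpa using half_lt_self hpos))
  exact (le_of_lt hw).trans (abs_im_le_norm_sub_ofReal w x)

theorem integrableOn_mul_inv_sub {S : Set ℝ} {ρ : ℝ → ℂ} (hρ : IntegrableOn ρ S) {z : ℂ}
    (hz : z.im ≠ 0) : IntegrableOn (fun x => ρ x * (z - (x : ℂ))⁻¹) S := by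
  refine Integrable.mul_bdd (c := |z.im|⁻¹) hρ (by fun_prop : Measurable fun x : ℝ =>
      (z - (x : ℂ))⁻¹).aestronglyMeasurable (Eventually.of_forall fun x => ?_)
  rw [norm_inv]
  exact inv_anti₀ (abs_pos.2 hz) (abs_im_le_norm_sub_ofReal z x)

theorem norm_dslope_le_of_norm_deriv_le {f : ℂ → ℂ} {s : Set ℂ} (hs : Convex ℝ s) {C : ℝ}
    (hf : ∀ z ∈ s, DifferentiableAt ℂ f z) (hC : ∀ z ∈ s, ‖deriv f z‖ ≤ C) {x z : ℂ}
    (hx : x ∈ s) (hz : z ∈ s) : ‖dslope f x z‖ ≤ C := by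
  rcases eq_or_ne z x with rfl | h
  · rw [dslope_same]
    exact hC _ hx
  · rw [dslope_of_ne _ h, slope_def_module, norm_smul, norm_inv,
      inv_mul_le_iff₀ (norm_pos_iff.2 (sub_ne_zero.2 h)), mul_comm]
    exact hs.norm_image_sub_le_of_norm_deriv_le hf hC hx hz

theorem dslope_comm' (f : ℂ → ℂ) (x z : ℂ) : dslope f x z = dslope f z x := by
  rcases eq_or_ne z x with rfl | h
  · rfl
  · rw [dslope_of_ne _ h, dslope_of_ne _ h.symm, slope_comm]

theorem integral_inv_sub_ofReal {a b : ℝ} (hab : a ≤ b) {z : ℂ} (hz : z.im ≠ 0) :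
    ∫ x in Ioo a b, (z - (x : ℂ))⁻¹ = log (z - a) - log (z - b) := by
  rw [← integral_Ioc_eq_integral_Ioo, ← intervalIntegral.integral_of_le hab]
  have hne : ∀ x : ℝ, z - (x : ℂ) ∈ slitPlane := fun x => Or.inr (by simpa using hz)
  have hderiv : ∀ x ∈ uIcc a b, HasDerivAt (fun x : ℝ => -log (z - (x : ℂ)))
      (z - (x : ℂ))⁻¹ x := by
    intro x _
    have h1 : HasDerivAt (fun x : ℝ => z - (x : ℂ)) (-1) x := by
      simpa using (ofRealCLM.hasDerivAt (x := x)).const_sub z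
    simpa [neg_div] using (h1.clog_real (hne x)).fun_neg
  rw [intervalIntegral.integral_eq_sub_of_hasDerivAt hderiv]
  · ring
  · refine ContinuousOn.intervalIntegrable ?_
    exact ContinuousOn.inv₀ (by fun_prop) fun x _ => slitPlane_ne_zero (hne x)

theorem log_neg_of_im_neg {z : ℂ} (hz : z.im < 0) : log (-z) = log z + Real.pi * I := by
  simp only [log, norm_neg, arg_neg_eq_arg_add_pi_of_im_neg hz]
  push_cast
  ring

theorem log_neg_of_im_pos {z : ℂ} (hz : 0 < z.im) : log (-z) = log z - Real.pi * I := by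
  simp only [log, norm_neg, arg_neg_eq_arg_sub_pi_of_im_pos hz]
  push_cast
  ring

/-- Near a positive real point, the Cauchy-type integral of a density `ρ` that extends
holomorphically to the right half-plane continues from the upper half-plane to the lower one, where
the continuation differs from the integral by `2πi ρ`. -/
theorem exists_local_continuation {ρ : ℂ → ℂ} (hρ : DifferentiableOn ℂ ρ {z | 0 < z.re})
    (hint : IntegrableOn (fun x : ℝ => ρ x) (Ioi 0)) {x₀ : ℝ} (hx₀ : 0 < x₀) :
    ∃ H : ℂ → ℂ, DifferentiableOn ℂ H (ball (x₀ : ℂ) (x₀ / 4)) ∧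
      (∀ z ∈ ball (x₀ : ℂ) (x₀ / 4), 0 < z.im →
        H z = ∫ x in Ioi (0 : ℝ), ρ x * (z - (x : ℂ))⁻¹) ∧
      (∀ z ∈ ball (x₀ : ℂ) (x₀ / 4), z.im < 0 →
        H z = (∫ x in Ioi (0 : ℝ), ρ x * (z - (x : ℂ))⁻¹) - 2 * Real.pi * I * ρ z) := by
  set a := x₀ / 2 with ha
  set b := 3 * x₀ / 2 with hb
  set U := ball (x₀ : ℂ) (x₀ / 4) with hU
  set V := ball (x₀ : ℂ) (x₀ / 2) with hV
  have hopen : IsOpen {z : ℂ | 0 < z.re} := isOpen_lt continuous_const continuous_re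
  have hre : ∀ z : ℂ, |z.re - x₀| ≤ dist z x₀ := fun z => by
    simpa [dist_eq] using abs_re_le_norm (z - (x₀ : ℂ))
  have hUV : U ⊆ V := ball_subset_ball (by linarith)
  have hVre : closedBall (x₀ : ℂ) (x₀ / 2) ⊆ {z : ℂ | 0 < z.re} := by
    intro z hz
    have h1 := (hre z).trans (mem_closedBall.1 hz)
    rw [abs_le] at h1
    rw [mem_ofPred_eq]
    linarith
  have hV' : V ⊆ closedBall (x₀ : ℂ) (x₀ / 2) := ball_subset_closedBall
  have hρV : ∀ z ∈ V, DifferentiableAt ℂ ρ z := fun z hz =>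
    hρ.differentiableAt (hopen.mem_nhds (hVre (hV' hz)))
  have hIoo : ∀ x ∈ Ioo a b, (x : ℂ) ∈ V := by
    intro x hx
    rw [hV, mem_ball, dist_eq, ← ofReal_sub, norm_real, Real.norm_eq_abs, abs_lt]
    constructor <;> linarith [hx.1, hx.2]
  obtain ⟨C, hC⟩ := (isCompact_closedBall (x₀ : ℂ) (x₀ / 2)).exists_bound_of_continuousOn
    ((hρ.deriv hopen).continuousOn.mono hVre)
  have hdslope : ∀ x ∈ Ioo a b, ∀ z ∈ V, ‖dslope ρ (x : ℂ) z‖ ≤ C := fun x hx z hz =>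
    norm_dslope_le_of_norm_deriv_le (convex_ball _ _) hρV (fun w hw => hC w (hV' hw))
      (hIoo x hx) hz
  have hdiffdslope : ∀ w ∈ V, DifferentiableOn ℂ (dslope ρ w) V := fun w hw =>
    (differentiableOn_dslope (isOpen_ball.mem_nhds hw)).2
      fun z hz => (hρV z hz).differentiableWithinAt
  have hmeas : ∀ z ∈ V, AEStronglyMeasurable (fun x : ℝ => dslope ρ (x : ℂ) z)
      (volume.restrict (Ioo a b)) := by
    intro z hz
    simp only [dslope_comm' ρ _ z]
    exact ((hdiffdslope z hz).continuousOn.comp continuous_ofReal.continuousOn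
      hIoo).aestronglyMeasurable measurableSet_Ioo
  have hconst : Integrable (fun _ : ℝ => C) (volume.restrict (Ioo a b)) :=
    integrable_const C
  let D : ℂ → ℂ := fun z => ∫ x in Ioo a b, dslope ρ (x : ℂ) z
  have hD : DifferentiableOn ℂ D V := by
    refine differentiableOn_integral_of_norm_le isOpen_ball hmeas ?_ ?_ hconst
    · filter_upwards [ae_restrict_mem measurableSet_Ioo] with x hx
      exact hdiffdslope x (hIoo x hx)
    · filter_upwards [ae_restrict_mem measurableSet_Ioo] with x hx
      exact hdslope x hx
  let E : ℂ → ℂ := fun z => ∫ x in Ioi (0 : ℝ) \ Ioo a b, ρ x * (z - (x : ℂ))⁻¹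
  have hE : DifferentiableOn ℂ E U := by
    refine differentiableOn_cauchyIntegral (measurableSet_Ioi.diff measurableSet_Ioo)
      (hint.mono_set sdiff_subset) isOpen_ball (δ := x₀ / 4) (by positivity) ?_
    intro z hz x hx
    have h1 : x₀ / 2 ≤ dist (x : ℂ) x₀ := by
      rw [dist_eq, ← ofReal_sub, norm_real, Real.norm_eq_abs, le_abs]
      by_contra! h
      exact hx.2 ⟨by linarith [h.2], by linarith [h.1]⟩
    have h2 := mem_ball.1 hz
    rw [← dist_eq]
    have h3 := dist_triangle (x : ℂ) z x₀
    rw [dist_comm (x : ℂ) z] at h3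
    linarith
  let L : ℂ → ℂ := fun z => log (z - a) - log (b - z)
  have hL : DifferentiableOn ℂ L U := by
    intro z hz
    have h1 := (hre z).trans_lt (mem_ball.1 hz)
    rw [abs_lt] at h1
    have h2 : z - a ∈ slitPlane := Or.inl (by simp only [sub_re, ofReal_re]; linarith [h1.1])
    have h3 : b - z ∈ slitPlane := Or.inl (by simp only [sub_re, ofReal_re]; linarith [h1.2])
    exact (((differentiableAt_id.sub_const _).clog h2).sub
      ((differentiableAt_id.const_sub _).clog h3)).differentiableWithinAt
  have key : ∀ z ∈ U, z.im ≠ 0 → ∫ x in Ioi (0 : ℝ), ρ x * (z - (x : ℂ))⁻¹ =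
      E z - D z + ρ z * (log (z - a) - log (z - b)) := by
    intro z hz him
    have hI := integrableOn_mul_inv_sub hint him
    have hsub : Ioo a b ⊆ Ioi 0 := fun x hx => (by positivity : 0 < a).trans hx.1
    have h1 : IntegrableOn (fun x : ℝ => dslope ρ (x : ℂ) z) (Ioo a b) := by
      refine hconst.mono' (hmeas z (hUV hz)) ?_
      filter_upwards [ae_restrict_mem measurableSet_Ioo] with x hx
      exact hdslope x hx z (hUV hz)
    have h2 : IntegrableOn (fun x : ℝ => ρ z * (z - (x : ℂ))⁻¹) (Ioo a b) :=
      integrableOn_mul_inv_sub (ρ := fun _ => ρ z) (integrable_const _) him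
    have h3 : ∫ x in Ioo a b, ρ x * (z - (x : ℂ))⁻¹ =
        ρ z * (log (z - a) - log (z - b)) - D z := by
      rw [← integral_inv_sub_ofReal (by linarith) him, ← integral_const_mul,
        ← integral_sub h2 h1]
      refine integral_congr_ae (Eventually.of_forall fun x => ?_)
      have hne : z - (x : ℂ) ≠ 0 := fun h => him (by simpa using congrArg im h)
      have h4 := sub_smul_dslope ρ (x : ℂ) z
      rw [smul_eq_mul] at h4
      simp only
      field_simp
      linear_combination h4
    have h5 := setIntegral_sdiff measurableSet_Ioo hI hsub
    simp only [E]
    rw [h5, h3]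
    ring
  refine ⟨fun z => E z - D z + ρ z * (L z - Real.pi * I), ?_, ?_, ?_⟩
  · exact (hE.sub (hD.mono hUV)).add ((hρ.mono (hUV.trans (hV'.trans hVre))).mul
      (hL.sub_const _))
  · intro z hz him
    rw [key z hz him.ne', ← neg_sub (b : ℂ) z, log_neg_of_im_neg (by simpa using him)]
    simp only [L]
    ring
  · intro z hz him
    rw [key z hz him.ne, ← neg_sub (b : ℂ) z, log_neg_of_im_pos (by simpa using him)]
    simp only [L]
    ring

/-- The Cauchy-type integral of a density `ρ` on `(0,∞)` that is holomorphic on the right half-plane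
and off the real axis continues across `(0,∞)`. -/
theorem exists_continuation {ρ : ℂ → ℂ} (hρ : DifferentiableOn ℂ ρ {z | 0 < z.re})
    (hρ' : ∀ z : ℂ, z.im < 0 → DifferentiableAt ℂ ρ z)
    (hint : IntegrableOn (fun x : ℝ => ρ x) (Ioi 0)) :
    ∃ f : ℂ → ℂ, AnalyticOnNhd ℂ f betaPrimeDomain ∧
      (∀ z : ℂ, 0 < z.im → f z = ∫ x in Ioi (0 : ℝ), ρ x * (z - (x : ℂ))⁻¹) ∧
      (∀ z : ℂ, z.im < 0 →
        f z = (∫ x in Ioi (0 : ℝ), ρ x * (z - (x : ℂ))⁻¹) - 2 * Real.pi * I * ρ z) := by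
  set C : ℂ → ℂ := fun z => ∫ x in Ioi (0 : ℝ), ρ x * (z - (x : ℂ))⁻¹ with hC
  let f : ℂ → ℂ := fun z => if 0 < z.im then C z else
    if z.im < 0 then C z - 2 * Real.pi * I * ρ z else limUnder (𝓝[{w | 0 < w.im}] z) C
  have hup : ∀ z : ℂ, 0 < z.im → f z = C z := fun z hz => by simp only [f, if_pos hz]
  have hlow : ∀ z : ℂ, z.im < 0 → f z = C z - 2 * Real.pi * I * ρ z := fun z hz => by
    simp only [f, if_neg hz.not_gt, if_pos hz]
  have hreal : ∀ z : ℂ, z.im = 0 → f z = limUnder (𝓝[{w | 0 < w.im}] z) C := fun z hz => by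
    simp only [f, hz, lt_irrefl, if_false]
  have hopen_up : IsOpen {z : ℂ | 0 < z.im} := isOpen_lt continuous_const continuous_im
  have hopen_low : IsOpen {z : ℂ | z.im < 0} := isOpen_lt continuous_im continuous_const
  refine ⟨f, fun z hz => ?_, hup, hlow⟩
  rcases lt_trichotomy z.im 0 with him | him | him
  · refine DifferentiableOn.analyticAt (s := {z : ℂ | z.im < 0}) ?_ (hopen_low.mem_nhds him)
    refine DifferentiableOn.congr (fun w hw => ?_) hlow
    exact ((differentiableAt_cauchyIntegral_of_im_ne_zero measurableSet_Ioi hint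
      (ne_of_lt hw)).sub ((hρ' w hw).const_mul _)).differentiableWithinAt
  · have hre : 0 < z.re := not_le.1 fun h => hz ⟨him, h⟩
    obtain ⟨H, hH, hHup, hHlow⟩ := exists_local_continuation hρ hint hre
    have hzeq : ((z.re : ℝ) : ℂ) = z := Complex.ext (by simp) (by simp [him])
    rw [hzeq] at hH hHup hHlow
    refine (hH.congr fun w hw => ?_).analyticAt (ball_mem_nhds z (by positivity))
    rcases lt_trichotomy w.im 0 with hw' | hw' | hw'
    · rw [hlow w hw', hHlow w hw hw']
    · have : (𝓝[{w | 0 < w.im}] w).NeBot := by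
        rw [← mem_closure_iff_nhdsWithin_neBot, closure_setOfPred_lt_im]
        exact hw'.ge
      rw [hreal w hw']
      refine Tendsto.limUnder_eq ?_
      have h1 : Tendsto H (𝓝[{w | 0 < w.im}] w) (𝓝 (H w)) :=
        (hH.differentiableAt (isOpen_ball.mem_nhds hw)).continuousAt.tendsto.mono_left
          nhdsWithin_le_nhds
      refine h1.congr' ?_
      filter_upwards [self_mem_nhdsWithin, nhdsWithin_le_nhds (isOpen_ball.mem_nhds hw)]
        with v hv hv'
      exact hHup v hv' hv
    · rw [hup w hw', hHup w hw hw']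
  · refine DifferentiableOn.analyticAt (s := {z : ℂ | 0 < z.im}) ?_ (hopen_up.mem_nhds him)
    refine DifferentiableOn.congr (fun w hw => ?_) hup
    exact (differentiableAt_cauchyIntegral_of_im_ne_zero measurableSet_Ioi hint
      (ne_of_gt hw)).differentiableWithinAt

theorem integrableOn_betaPrime_density {p q : ℝ} (hp : 0 < p) (hq : 0 < q) :
    IntegrableOn (fun x : ℝ => x ^ (p - 1) * (1 + x) ^ (-(p + q))) (Ioi 0) := by
  have hmeas : Measurable fun x : ℝ => x ^ (p - 1) * (1 + x) ^ (-(p + q)) := by fun_prop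
  rw [← Ioc_union_Ioi_eq_Ioi zero_le_one, integrableOn_union]
  constructor
  · have h : IntegrableOn (fun x : ℝ => x ^ (p - 1)) (Ioc 0 1) :=
      (intervalIntegrable_iff_integrableOn_Ioc_of_le zero_le_one).1
        (intervalIntegral.intervalIntegrable_rpow' (by linarith))
    refine h.mono' hmeas.aestronglyMeasurable ?_
    filter_upwards [ae_restrict_mem measurableSet_Ioc] with x hx
    have hx0 : 0 < x := hx.1
    rw [Real.norm_of_nonneg (by positivity)]
    exact mul_le_of_le_one_right (by positivity)
      (Real.rpow_le_one_of_one_le_of_nonpos (by linarith) (by linarith))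
  · have h : IntegrableOn (fun x : ℝ => x ^ (-q - 1)) (Ioi 1) :=
      integrableOn_Ioi_rpow_of_lt (by linarith) zero_lt_one
    refine h.mono' hmeas.aestronglyMeasurable ?_
    filter_upwards [ae_restrict_mem measurableSet_Ioi] with x hx
    have hx0 : 0 < x := zero_lt_one.trans hx
    rw [Real.norm_of_nonneg (by positivity), show -q - 1 = (p - 1) + -(p + q) by ring,
      Real.rpow_add hx0]
    exact mul_le_mul_of_nonneg_left
      (Real.rpow_le_rpow_of_nonpos hx0 (by linarith) (by linarith)) (by positivity)

theorem ofReal_betaPrime_density (p q : ℝ) {x : ℝ} (hx : 0 < x) :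
    ((x ^ (p - 1) * (1 + x) ^ (-(p + q)) / betaFun p q : ℝ) : ℂ) =
      (x : ℂ) ^ ((p : ℂ) - 1) / (1 + (x : ℂ)) ^ ((p : ℂ) + q) / (betaFun p q : ℂ) := by
  rw [ofReal_div, ofReal_mul, ofReal_cpow hx.le, ofReal_cpow (by linarith : 0 ≤ 1 + x)]
  push_cast
  rw [cpow_neg, ← div_eq_mul_inv]

theorem betaFun_nonneg (p q : ℝ) : 0 ≤ betaFun p q :=
  setIntegral_nonneg measurableSet_Ioo fun _ hx =>
    mul_nonneg (Real.rpow_nonneg hx.1.le _) (Real.rpow_nonneg (sub_nonneg.2 hx.2.le) _)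

theorem cauchyT_betaPrimeMeasure (p q : ℝ) (z : ℂ) :
    cauchyT (betaPrimeMeasure p q) z = ∫ x in Ioi (0 : ℝ),
      (x : ℂ) ^ ((p : ℂ) - 1) / (1 + (x : ℂ)) ^ ((p : ℂ) + q) / (betaFun p q : ℂ) *
        (z - (x : ℂ))⁻¹ := by
  rw [cauchyT, betaPrimeMeasure, integral_withDensity_eq_integral_toReal_smul
    (Measurable.ennreal_ofReal (Measurable.indicator (by fun_prop) measurableSet_Ioi))
    (Eventually.of_forall fun _ => ENNReal.ofReal_lt_top), ← integral_indicator measurableSet_Ioi]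
  refine integral_congr_ae (Eventually.of_forall fun x => ?_)
  by_cases hx : x ∈ Ioi (0 : ℝ)
  · have hx0 : 0 < x := hx
    have := betaFun_nonneg p q
    simp only [indicator_of_mem hx]
    rw [ENNReal.toReal_ofReal (by positivity), ← ofReal_betaPrime_density p q hx0, real_smul]
  · simp [indicator_of_notMem hx]

theorem stmt_8 (p q : ℝ) (hp : 0 < p) (hq : 0 < q) :
    ∃ f : ℂ → ℂ, AnalyticOnNhd ℂ f betaPrimeDomain ∧
      (∀ z : ℂ, 0 < z.im → f z = cauchyT (betaPrimeMeasure p q) z) ∧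
      (∀ z : ℂ, z.im < 0 →
        f z = cauchyT (betaPrimeMeasure p q) z
          - (2 * (Real.pi : ℂ) * Complex.I / ((betaFun p q : ℝ) : ℂ))
            * z ^ ((p : ℂ) - 1) / (1 + z) ^ ((p : ℂ) + (q : ℂ))) := by
  let ρ : ℂ → ℂ := fun z =>
    z ^ ((p : ℂ) - 1) / (1 + z) ^ ((p : ℂ) + (q : ℂ)) / (betaFun p q : ℂ)
  have hdiff : ∀ z : ℂ, z ∈ slitPlane → 1 + z ∈ slitPlane → DifferentiableAt ℂ ρ z := by
    intro z h1 h2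
    refine ((differentiableAt_id.cpow_const h1).div
      ((differentiableAt_id.const_add 1).cpow_const h2) ?_).div_const _
    simp [cpow_eq_zero_iff, slitPlane_ne_zero h2]
  obtain ⟨f, hf, hup, hlow⟩ := exists_continuation (ρ := ρ)
    (fun z (hz : 0 < z.re) => (hdiff z (Or.inl hz)
      (Or.inl (by simpa using by linarith))).differentiableWithinAt)
    (fun z hz => hdiff z (Or.inr hz.ne) (Or.inr (by simpa using hz.ne)))
    (((integrableOn_betaPrime_density hp hq).div_const (betaFun p q)).ofReal.congr (by
      filter_upwards [ae_restrict_mem measurableSet_Ioi] with x hx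
      exact ofReal_betaPrime_density p q hx))
  refine ⟨f, hf, fun z hz => ?_, fun z hz => ?_⟩
  · rw [hup z hz, cauchyT_betaPrimeMeasure]
  · rw [hlow z hz, cauchyT_betaPrimeMeasure]
    simp only [ρ]
    ring
end
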